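/- Let S_D be the symmetric 3×3 real matrix with rows (0,0,1),(0,1,0),(1,0,0) (the Petrov type D normal form, with Ψ₂ = 1 and all other curvature components zero). Then the stabilizer algebra stab(S_D) = {A ∈ so(G) : Aᵀ·S_D + S_D·A = 0} is exactly the one-dimensional span of the boost generator B = diag(1,0,−1). -/

import Mathlib

open Matrix

/-- The Gram matrix of the 3-dimensional Lorentzian inner product in a null triad. -/
noncomputable def Gmat : Matrix (Fin 3) (Fin 3) ℝ := !![0, 0, -1; 0, 1/2, 0; -1, 0, 0]

/-- The stabilizer algebra of a symmetric matrix `S` inside `so(G)`: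
matrices `A` with `Aᵀ·G + G·A = 0` and `Aᵀ·S + S·A = 0`. -/
noncomputable def stab (S : Matrix (Fin 3) (Fin 3) ℝ) :
    Submodule ℝ (Matrix (Fin 3) (Fin 3) ℝ) where
  carrier := {A | Aᵀ * Gmat + Gmat * A = 0 ∧ Aᵀ * S + S * A = 0}
  zero_mem' := by constructor <;> simp
  add_mem' := by
    rintro a b ⟨ha1, ha2⟩ ⟨hb1, hb2⟩
    constructor
    · have h : (a + b)ᵀ * Gmat + Gmat * (a + b)
          = (aᵀ * Gmat + Gmat * a) + (bᵀ * Gmat + Gmat * b) := by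
        rw [Matrix.transpose_add]; noncomm_ring
      rw [h, ha1, hb1, add_zero]
    · have h : (a + b)ᵀ * S + S * (a + b)
          = (aᵀ * S + S * a) + (bᵀ * S + S * b) := by
        rw [Matrix.transpose_add]; noncomm_ring
      rw [h, ha2, hb2, add_zero]
  smul_mem' := by
    rintro c a ⟨ha1, ha2⟩
    constructor
    · have h : (c • a)ᵀ * Gmat + Gmat * (c • a) = c • (aᵀ * Gmat + Gmat * a) := by
        rw [Matrix.transpose_smul, Matrix.smul_mul, Matrix.mul_smul, smul_add]
      rw [h, ha1, smul_zero]
    · have h : (c • a)ᵀ * S + S * (c • a) = c • (aᵀ * S + S * a) := by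
        rw [Matrix.transpose_smul, Matrix.smul_mul, Matrix.mul_smul, smul_add]
      rw [h, ha2, smul_zero]

/-- The Petrov type D normal form. -/
noncomputable def S_D : Matrix (Fin 3) (Fin 3) ℝ := !![0, 0, 1; 0, 1, 0; 1, 0, 0]

/-- The boost generator `diag(1, 0, -1)`. -/
noncomputable def Bboost : Matrix (Fin 3) (Fin 3) ℝ := !![1, 0, 0; 0, 0, 0; 0, 0, -1]

/-- The stabilizer algebra of the Petrov type D normal form is exactly the
one-dimensional span of the boost generator (table entry `s₀ = 1` for type D). -/
theorem stab_typeD : stab S_D = Submodule.span ℝ {Bboost} := by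
  apply le_antisymm
  · rintro A ⟨hG, hS⟩
    rw [Submodule.mem_span_singleton]
    have g := fun i j => congrFun (congrFun hG i) j
    have s := fun i j => congrFun (congrFun hS i) j
    simp [Gmat, S_D, Matrix.mul_apply, Matrix.vecMul, dotProduct, Fin.sum_univ_three,
      Fin.forall_fin_succ] at g s
    obtain ⟨⟨_, _, _⟩, ⟨_, _, _⟩, _, _, _⟩ := g
    obtain ⟨⟨_, _, _⟩, ⟨_, _, _⟩, _, _, _⟩ := s
    refine ⟨A 0 0, ?_⟩
    ext i j
    fin_cases i <;> fin_cases j <;> simp [Bboost] <;> linarith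
  · rw [Submodule.span_singleton_le_iff_mem]
    constructor <;> ext i j <;> fin_cases i <;> fin_cases j <;>
      simp [Bboost, Gmat, S_D, Matrix.mul_apply, Fin.sum_univ_three]
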